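/- Let K be a compact Hausdorff scattered space with Cantor–Bendixson derivatives K^{(β)}, and for each ordinal α let X_α = {f ∈ C(K) : f(t) = 0 for all t ∈ K^{(α)}}. Then for every ordinal α the quotient Banach space X_{α+1}/X_α is isomorphic (linearly homeomorphic) to c₀(K^{(α)} \ K^{(α+1)}), the space of real functions on the index set K^{(α)} \ K^{(α+1)} vanishing at infinity, with the supremum norm. -/

import Mathlib

open Filter Topology ZeroAtInfty

/-- The `α`-th Cantor–Bendixson derivative of the topological space `K`:
`K⁽⁰⁾ = K`, `K⁽ᵅ⁺¹⁾` is the set of accumulation points of `K⁽ᵅ⁾`, and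
`K⁽ᵅ⁾ = ⋂_{β<α} K⁽ᵝ⁾` at limit ordinals. -/
noncomputable def cantorBendixson (K : Type*) [TopologicalSpace K] (α : Ordinal) : Set K :=
  Ordinal.limitRecOn α Set.univ (fun _ ih => derivedSet ih)
    (fun o _ ih => ⋂ β, ⋂ h : β < o, ih β h)

/-- The subspace of `C(K)` of functions vanishing on a given subset `S ⊆ K`. -/
def vanishingOn (K : Type*) [TopologicalSpace K] (S : Set K) : Submodule ℝ C(K, ℝ) where
  carrier := {f | ∀ t ∈ S, f t = 0}
  add_mem' := by
    intro f g hf hg t ht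
    simp [hf t ht, hg t ht]
  zero_mem' := by
    intro t ht
    simp
  smul_mem' := by
    intro c f hf t ht
    simp [hf t ht]

open Set

theorem isClosed_cantorBendixson (K : Type*) [TopologicalSpace K] [T1Space K] (α : Ordinal) :
    IsClosed (cantorBendixson K α) := by
  induction α using Ordinal.limitRecOn with
  | zero => simp [cantorBendixson]
  | add_one α _ => simp [cantorBendixson, isClosed_derivedSet]
  | limit α hα ih =>
    rw [cantorBendixson, Ordinal.limitRecOn_limit _ _ _ _ hα]
    exact isClosed_iInter fun β => isClosed_iInter fun hβ => ih β hβ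

theorem cantorBendixson_add_one (K : Type*) [TopologicalSpace K] (α : Ordinal) :
    cantorBendixson K (α + 1) = derivedSet (cantorBendixson K α) := by
  simp [cantorBendixson]

theorem cantorBendixson_add_one_subset (K : Type*) [TopologicalSpace K] [T1Space K]
    (α : Ordinal) : cantorBendixson K (α + 1) ⊆ cantorBendixson K α := by
  rw [cantorBendixson_add_one]
  exact (isClosed_iff_derivedSet_subset _).1 (isClosed_cantorBendixson K α)

section QuotientKer

variable {E F : Type*} [AddCommGroup E] [Module ℝ E] [TopologicalSpace E]
  [IsTopologicalAddGroup E] [AddCommGroup F] [Module ℝ F] [TopologicalSpace F]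

/-- The isomorphism from the quotient by the kernel of an open surjective continuous linear
map onto its codomain. -/
noncomputable def ContinuousLinearMap.quotientEquivOfIsOpenMap (T : E →L[ℝ] F)
    (p : Submodule ℝ E) (hp : p = T.ker) (hsurj : Function.Surjective T) (hopen : IsOpenMap T) :
    (E ⧸ p) ≃L[ℝ] F where
  toLinearEquiv := (Submodule.quotEquivOfEq p T.ker hp).trans
    ((T : E →ₗ[ℝ] F).quotKerEquivOfSurjective hsurj)
  continuous_toFun := by
    refine p.isQuotientMap_mkQ.continuous_iff.2 ?_
    exact T.continuous
  continuous_invFun := by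
    refine (hopen.isQuotientMap T.continuous hsurj).continuous_iff.2 ?_
    convert p.continuous_mkQ using 1
    ext x
    exact ((Submodule.quotEquivOfEq p T.ker hp).trans
      ((T : E →ₗ[ℝ] F).quotKerEquivOfSurjective hsurj)).symm_apply_apply (p.mkQ x)

end QuotientKer

section Restriction

variable {K : Type*} [TopologicalSpace K]

theorem isClosed_vanishingOn (S : Set K) : IsClosed (vanishingOn K S : Set C(K, ℝ)) := by
  have h : (vanishingOn K S : Set C(K, ℝ)) = ⋂ t ∈ S, {f : C(K, ℝ) | f t = 0} := by
    ext f
    simp only [mem_iInter]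
    rfl
  rw [h]
  exact isClosed_biInter fun t _ =>
    isClosed_eq (continuous_eval_const t) continuous_const

theorem tendsto_cocompact_diff_of_eqOn_zero {A B : Set K} (hA : IsCompact A) {f : K → ℝ}
    (hf : Continuous f) (h : ∀ t ∈ B, f t = 0) :
    Tendsto (fun x : ↥(A \ B) => f x) (cocompact ↥(A \ B)) (𝓝 0) := by
  refine Metric.tendsto_nhds.2 fun ε hε => ?_
  have hc : IsCompact {x : ↥(A \ B) | ε ≤ |f x|} := by
    rw [Subtype.isCompact_iff]
    convert hA.inter_right (isClosed_le continuous_const hf.abs : IsClosed {x | ε ≤ |f x|}) using 1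
    ext x
    simp only [mem_image, mem_ofPred_eq, Subtype.exists, mem_inter_iff, Set.mem_sdiff]
    constructor
    · rintro ⟨y, hy, hy', rfl⟩
      exact ⟨hy.1, hy'⟩
    · rintro ⟨hx, hx'⟩
      refine ⟨x, ⟨hx, fun hB => ?_⟩, hx', rfl⟩
      rw [h x hB, abs_zero] at hx'
      exact hx'.not_gt hε
  filter_upwards [hc.compl_mem_cocompact] with x hx
  simpa using hx

theorem continuousOn_extend_zero [T2Space K] {A B : Set K} (hB : IsClosed B)
    (g : C₀(↥(A \ B), ℝ)) : ContinuousOn (Function.extend Subtype.val g 0) A := by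
  set F : K → ℝ := Function.extend Subtype.val g 0
  have hF (x : ↥(A \ B)) : F x = g x := Subtype.val_injective.extend_apply _ _ _
  have hF' (x : K) (hx : x ∉ A \ B) : F x = 0 :=
    Function.extend_apply' _ _ _ (by rintro ⟨y, rfl⟩; exact hx y.2)
  intro x hx
  by_cases hxB : x ∈ B
  · rw [ContinuousWithinAt, hF' x fun h => h.2 hxB]
    refine Metric.tendsto_nhds.2 fun ε hε => ?_
    obtain ⟨C, hC, hCg⟩ := mem_cocompact.1
      (Metric.tendsto_nhds.1 (zero_at_infty g) ε hε)
    have hx' : (Set.image Subtype.val C)ᶜ ∈ 𝓝 x :=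
      (hC.image continuous_subtype_val).isClosed.isOpen_compl.mem_nhds
        (by rintro ⟨y, -, rfl⟩; exact y.2.2 hxB)
    filter_upwards [mem_nhdsWithin_of_mem_nhds hx'] with y hy
    by_cases hyD : y ∈ A \ B
    · rw [hF ⟨y, hyD⟩]
      exact hCg fun hyC => hy ⟨_, hyC, rfl⟩
    · simpa [hF' y hyD] using hε
  · have hD : ContinuousOn F (A \ B) := by
      rw [continuousOn_iff_continuous_domRestrict]
      convert map_continuous g using 1
      ext x
      exact hF x
    exact (hD x ⟨hx, hxB⟩).mono_of_mem_nhdsWithin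
      (inter_mem self_mem_nhdsWithin (mem_nhdsWithin_of_mem_nhds (hB.isOpen_compl.mem_nhds hxB)))

variable [CompactSpace K]

/-- Restriction to `A \ B` of the continuous functions vanishing on `B`. -/
noncomputable def vanishingOn.restrictDiff {A B : Set K} (hA : IsClosed A) :
    ↥(vanishingOn K B) →L[ℝ] C₀(↥(A \ B), ℝ) :=
  LinearMap.mkContinuous
    { toFun := fun f =>
        { toFun := fun x => f.1 x
          continuous_toFun := f.1.continuous.comp continuous_subtype_val
          zero_at_infty' :=
            tendsto_cocompact_diff_of_eqOn_zero hA.isCompact f.1.continuous f.2 }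
      map_add' := fun _ _ => rfl
      map_smul' := fun _ _ => rfl } 1 fun f => by
    rw [one_mul, ← ZeroAtInftyContinuousMap.norm_toBCF_eq_norm,
      BoundedContinuousFunction.norm_le (norm_nonneg _)]
    exact fun x => f.1.norm_coe_le_norm x

theorem vanishingOn.ker_restrictDiff {A B : Set K} (hA : IsClosed A) :
    (vanishingOn.restrictDiff hA : ↥(vanishingOn K B) →L[ℝ] C₀(↥(A \ B), ℝ)).ker =
      (vanishingOn K A).comap (vanishingOn K B).subtype := by
  ext f
  constructor
  · intro hf t ht
    by_cases htB : t ∈ B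
    · exact f.2 t htB
    · exact DFunLike.congr_fun (show vanishingOn.restrictDiff hA f = 0 from hf) ⟨t, ht, htB⟩
  · intro hf
    exact ZeroAtInftyContinuousMap.ext fun x => hf x x.2.1

theorem vanishingOn.restrictDiff_surjective [T2Space K] {A B : Set K} (hA : IsClosed A)
    (hB : IsClosed B) (hBA : B ⊆ A) :
    Function.Surjective
      (vanishingOn.restrictDiff hA : ↥(vanishingOn K B) →L[ℝ] C₀(↥(A \ B), ℝ)) := by
  intro g
  obtain ⟨f, hf⟩ := ContinuousMap.exists_restrict_eq hA
    ⟨_, (continuousOn_extend_zero hB g).domRestrict⟩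
  have hf' (x : K) (hx : x ∈ A) : f x = Function.extend Subtype.val g 0 x :=
    DFunLike.congr_fun hf ⟨x, hx⟩
  refine ⟨⟨f, fun t ht => ?_⟩, ?_⟩
  · rw [hf' t (hBA ht), Function.extend_apply' _ _ _ (by rintro ⟨y, rfl⟩; exact y.2.2 ht)]
    rfl
  · ext x
    exact (hf' x x.2.1).trans (Subtype.val_injective.extend_apply _ _ _)

end Restriction

/-- For a compact Hausdorff scattered space `K` with Cantor–Bendixson derivatives `K⁽ᵝ⁾` and
`X_β = {f ∈ C(K) | f = 0 on K⁽ᵝ⁾}`, the quotient `X_{α+1}/X_α` is isomorphic (linearly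
homeomorphic) to `c₀(K⁽ᵅ⁾ \ K⁽ᵅ⁺¹⁾)`, the space of real functions on the (discrete) index
set `K⁽ᵅ⁾ \ K⁽ᵅ⁺¹⁾` vanishing at infinity, with the supremum norm. -/
theorem quotient_vanishingOn_isomorphic_c0
    (K : Type*) [TopologicalSpace K] [CompactSpace K] [T2Space K]
    (hscat : ∀ S : Set K, S.Nonempty → ∃ x ∈ S, x ∉ derivedSet S) (α : Ordinal) :
    Nonempty
      ((↥(vanishingOn K (cantorBendixson K (α + 1))) ⧸
          (vanishingOn K (cantorBendixson K α)).comap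
            (vanishingOn K (cantorBendixson K (α + 1))).subtype) ≃L[ℝ]
        C₀(↥(cantorBendixson K α \ cantorBendixson K (α + 1)), ℝ)) := by
  have hA := isClosed_cantorBendixson K α
  have hB := isClosed_cantorBendixson K (α + 1)
  have hBA := cantorBendixson_add_one_subset K α
  have : CompleteSpace ↥(vanishingOn K (cantorBendixson K (α + 1))) :=
    (isClosed_vanishingOn _).completeSpace_coe
  have hsurj := vanishingOn.restrictDiff_surjective hA hB hBA
  exact ⟨(vanishingOn.restrictDiff hA).quotientEquivOfIsOpenMap _
    (vanishingOn.ker_restrictDiff hA).symm hsurj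
    (ContinuousLinearMap.isOpenMap (𝕜 := ℝ) (𝕜' := ℝ) (σ := RingHom.id ℝ)
      (E := ↥(vanishingOn K (cantorBendixson K (α + 1))))
      (F := C₀(↥(cantorBendixson K α \ cantorBendixson K (α + 1)), ℝ)) _ hsurj)⟩
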